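/- Fix integers K and t with 1 ≤ t ≤ K − 1. Let L be the graph whose vertex set is {(i, A) : i ∈ {1, …, K}, A ⊆ {1, …, K} \ {i}, |A| = t}, with two distinct vertices (i, A) and (j, A') adjacent iff i = j or A = A'. Then: (i) for every B ⊆ {1, …, K} with |B| = t + 1, the set C'_B = {(i, B \ {i}) : i ∈ B} has t + 1 elements, and any two distinct vertices of C'_B are non-adjacent in L and have no common neighbor in L (i.e., C'_B is a clique of the complement of L² of size t + 1); (ii) the union of the sets C'_B over all (t+1)-subsets B of {1, …, K} is the entire vertex set of L. -/

import Mathlib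

open SimpleGraph

/-- The square of a graph `G`: same vertex set, `u ≠ v` adjacent iff they are adjacent in `G`
or have a common neighbor in `G`. -/
def SimpleGraph.square {V : Type*} (G : SimpleGraph V) : SimpleGraph V where
  Adj u v := u ≠ v ∧ (G.Adj u v ∨ ∃ w, G.Adj u w ∧ G.Adj w v)
  symm := by
    refine ⟨?_⟩
    rintro u v ⟨huv, h | ⟨w, hw1, hw2⟩⟩
    · exact ⟨huv.symm, Or.inl h.symm⟩
    · exact ⟨huv.symm, Or.inr ⟨w, hw2.symm, hw1.symm⟩⟩
  loopless := by refine ⟨?_⟩; rintro u ⟨h, -⟩; exact h rfl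

/-- The vertices of the Ali–Niesen caching line graph: pairs `(i, A)` with
`i ∈ [K]`, `A ⊆ [K] \ {i}`, `|A| = t`. -/
def ANvertex (K t : ℕ) : Type :=
  {p : Fin K × Finset (Fin K) // p.1 ∉ p.2 ∧ p.2.card = t}

/-- The Ali–Niesen caching line graph: distinct vertices `(i, A)` and `(j, A')` are
adjacent iff `i = j` or `A = A'`. -/
def ANgraph (K t : ℕ) : SimpleGraph (ANvertex K t) where
  Adj v w := v ≠ w ∧ (v.val.1 = w.val.1 ∨ v.val.2 = w.val.2)
  symm := by
    refine ⟨?_⟩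
    rintro v w ⟨hvw, h | h⟩
    · exact ⟨hvw.symm, Or.inl h.symm⟩
    · exact ⟨hvw.symm, Or.inr h.symm⟩
  loopless := by refine ⟨?_⟩; rintro v ⟨h, -⟩; exact h rfl

/-- The clique `{(i, B \ {i}) : i ∈ B}` has as many elements as `B`. -/
lemma ANvertex.ncard_erase_eq {K t : ℕ} {B : Finset (Fin K)} (hB : B.card = t + 1) :
    {v : ANvertex K t | v.val.1 ∈ B ∧ v.val.2 = B.erase v.val.1}.ncard = t + 1 := by
  rw [← hB, ← Set.ncard_coe_finset B]
  refine Set.ncard_congr (fun v _ ↦ v.val.1) (fun v hv ↦ hv.1) ?_ ?_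
  · rintro u v ⟨-, hu⟩ ⟨-, hv⟩ huv
    exact Subtype.ext (Prod.ext huv (by rw [hu, hv, huv]))
  · intro i hi
    refine ⟨⟨(i, B.erase i), Finset.notMem_erase i B, ?_⟩, ⟨hi, rfl⟩, rfl⟩
    simp [Finset.card_erase_of_mem (Finset.mem_coe.mp hi), hB]

/-- Distinct vertices `(i, B \ {i})` and `(j, B \ {j})` are not adjacent. -/
lemma ANgraph.not_adj_of_erase {K t : ℕ} {B : Finset (Fin K)} {u v : ANvertex K t}
    (hu : u.val.1 ∈ B ∧ u.val.2 = B.erase u.val.1)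
    (hv : v.val.1 ∈ B ∧ v.val.2 = B.erase v.val.1) :
    ¬ (ANgraph K t).Adj u v := by
  rintro ⟨hne, h⟩
  have hfst : u.val.1 = v.val.1 :=
    h.elim id fun h ↦ Finset.erase_injOn B hu.1 hv.1 (hu.2 ▸ hv.2 ▸ h)
  exact hne (Subtype.ext (Prod.ext hfst (by rw [hu.2, hv.2, hfst])))

/-- Distinct vertices `(i, B \ {i})` and `(j, B \ {j})` have no common neighbor. -/
lemma ANgraph.not_adj_and_adj_of_erase {K t : ℕ} {B : Finset (Fin K)} {u v : ANvertex K t}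
    (hu : u.val.1 ∈ B ∧ u.val.2 = B.erase u.val.1)
    (hv : v.val.1 ∈ B ∧ v.val.2 = B.erase v.val.1) (hne : u ≠ v) (w : ANvertex K t) :
    ¬ ((ANgraph K t).Adj u w ∧ (ANgraph K t).Adj w v) := by
  rintro ⟨⟨-, huw⟩, ⟨-, hwv⟩⟩
  have hfst : u.val.1 ≠ v.val.1 := fun h ↦ not_adj_of_erase hu hv ⟨hne, Or.inl h⟩
  rcases huw with h₁ | h₁ <;> rcases hwv with h₂ | h₂
  · exact hfst (h₁.trans h₂)
  · exact w.property.1 (h₁ ▸ h₂ ▸ hv.2 ▸ Finset.mem_erase.mpr ⟨hfst, hu.1⟩)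
  · exact w.property.1 (h₂ ▸ h₁ ▸ hu.2 ▸ Finset.mem_erase.mpr ⟨hfst.symm, hv.1⟩)
  · exact not_adj_of_erase hu hv ⟨hne, Or.inr (h₁.trans h₂)⟩

/-- in the Ali–Niesen caching line graph `L`, for every `(t+1)`-subset `B`
of `[K]` the set `C'_B = {(i, B \ {i}) : i ∈ B}` has `t+1` elements and is a clique of the
complement of `L²` (any two of its distinct vertices are non-adjacent in `L` and share no
common neighbor in `L`), and the sets `C'_B` cover the whole vertex set. -/
theorem ali_niesen_compl_square_clique_cover (K t : ℕ) (ht : 1 ≤ t) (htK : t ≤ K - 1) :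
    (∀ B : Finset (Fin K), B.card = t + 1 →
      {v : ANvertex K t | v.val.1 ∈ B ∧ v.val.2 = B.erase v.val.1}.ncard = t + 1 ∧
      (∀ u ∈ {v : ANvertex K t | v.val.1 ∈ B ∧ v.val.2 = B.erase v.val.1},
       ∀ v ∈ {v : ANvertex K t | v.val.1 ∈ B ∧ v.val.2 = B.erase v.val.1}, u ≠ v →
        ¬ (ANgraph K t).Adj u v ∧
        ∀ w : ANvertex K t, ¬ ((ANgraph K t).Adj u w ∧ (ANgraph K t).Adj w v)) ∧
      (((ANgraph K t).square)ᶜ.IsClique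
        {v : ANvertex K t | v.val.1 ∈ B ∧ v.val.2 = B.erase v.val.1})) ∧
    (⋃ B ∈ {B : Finset (Fin K) | B.card = t + 1},
      {v : ANvertex K t | v.val.1 ∈ B ∧ v.val.2 = B.erase v.val.1}) = Set.univ := by
  refine ⟨fun B hB ↦ ⟨ANvertex.ncard_erase_eq hB, fun u hu v hv hne ↦
    ⟨ANgraph.not_adj_of_erase hu hv, ANgraph.not_adj_and_adj_of_erase hu hv hne⟩, ?_⟩, ?_⟩
  · intro u hu v hv hne
    refine (SimpleGraph.compl_adj _ _ _).mpr ⟨hne, ?_⟩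
    rintro ⟨-, h | ⟨w, hw⟩⟩
    · exact ANgraph.not_adj_of_erase hu hv h
    · exact ANgraph.not_adj_and_adj_of_erase hu hv hne w hw
  · refine Set.eq_univ_of_forall fun v ↦ Set.mem_iUnion₂.mpr ⟨insert v.val.1 v.val.2, ?_, ?_, ?_⟩
    · exact (Finset.card_insert_of_notMem v.property.1).trans (congrArg (· + 1) v.property.2)
    · exact Finset.mem_insert_self _ _
    · exact (Finset.erase_insert v.property.1).symm
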